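/- Degree form of the Regularity Lemma: For every ε > 0 and every positive integer k₀ there exists N = N(ε, k₀) such that for every d ∈ [0,1) and every finite simple graph G on n ≥ N vertices there exist a partition of the vertex set of G into sets V₀, V₁, …, V_k and a spanning subgraph G' of G such that: (i) k₀ ≤ k ≤ N and |V₀| ≤ εn; (ii) |V₁| = ⋯ = |V_k| = m for some m; (iii) every vertex x satisfies d_{G'}(x) > d_G(x) − (d + ε)n; (iv) for every i ≥ 1 the induced subgraph G'[V_i] has no edges; (v) for all 1 ≤ i < j ≤ k the pair (V_i, V_j) is ε-regular in G' and its density d_{G'}(V_i,V_j) is either 0 or greater than d. -/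

import Mathlib

open Finset
open scoped Classical

/-- The number of edges of `G` between `A` and `B` (for disjoint `A`, `B`). -/
noncomputable def edgeCnt {V : Type*} (G : SimpleGraph V) (A B : Finset V) : ℕ :=
  ((A ×ˢ B).filter fun p => G.Adj p.1 p.2).card

/-- The density of the pair `(A, B)` in `G`. -/
noncomputable def pairDensity {V : Type*} (G : SimpleGraph V) (A B : Finset V) : ℝ :=
  (edgeCnt G A B : ℝ) / ((A.card : ℝ) * (B.card : ℝ))

/-- The pair `(A, B)` is `ε`-regular in `G`. -/
def IsRegularPair {V : Type*} (G : SimpleGraph V) (ε : ℝ) (A B : Finset V) : Prop :=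
  ∀ X ⊆ A, ∀ Y ⊆ B, ε * (A.card : ℝ) ≤ (X.card : ℝ) → ε * (B.card : ℝ) ≤ (Y.card : ℝ) →
    |pairDensity G A B - pairDensity G X Y| < ε

lemma pairDensity_eq_edgeDensity {V : Type*} (G : SimpleGraph V) (A B : Finset V) :
    pairDensity G A B = (G.edgeDensity A B : ℝ) := by
  simp [pairDensity, edgeCnt, SimpleGraph.edgeDensity, Rel.edgeDensity, Rel.interedges]

lemma pairDensity_comm {V : Type*} (G : SimpleGraph V) (A B : Finset V) :
    pairDensity G A B = pairDensity G B A := by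
  rw [pairDensity_eq_edgeDensity, pairDensity_eq_edgeDensity, SimpleGraph.edgeDensity_comm]

lemma IsRegularPair.symm {V : Type*} {G : SimpleGraph V} {ε : ℝ} {A B : Finset V}
    (h : IsRegularPair G ε A B) : IsRegularPair G ε B A := by
  intro X hX Y hY hXc hYc
  rw [pairDensity_comm G B, pairDensity_comm G X]
  exact h Y hY X hX hYc hXc

lemma pairDensity_congr {V : Type*} {G H : SimpleGraph V} {A B : Finset V}
    (h : ∀ x ∈ A, ∀ y ∈ B, (G.Adj x y ↔ H.Adj x y)) : pairDensity G A B = pairDensity H A B := by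
  have : edgeCnt G A B = edgeCnt H A B :=
    congrArg card <| filter_congr fun p hp ↦
      h _ (mem_product.1 hp).1 _ (mem_product.1 hp).2
  rw [pairDensity, pairDensity, this]

lemma IsRegularPair.congr {V : Type*} {G H : SimpleGraph V} {ε : ℝ} {A B : Finset V}
    (hG : IsRegularPair G ε A B) (h : ∀ x ∈ A, ∀ y ∈ B, (G.Adj x y ↔ H.Adj x y)) :
    IsRegularPair H ε A B := by
  intro X hX Y hY hXc hYc
  rw [← pairDensity_congr h, ← pairDensity_congr fun x hx y hy ↦ h x (hX hx) y (hY hy)]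
  exact hG X hX Y hY hXc hYc

lemma pairDensity_bot {V : Type*} (A B : Finset V) :
    pairDensity (⊥ : SimpleGraph V) A B = 0 := by
  simp [pairDensity, edgeCnt]

lemma isRegularPair_bot {V : Type*} {ε : ℝ} (hε : 0 < ε) (A B : Finset V) :
    IsRegularPair (⊥ : SimpleGraph V) ε A B := by
  intro X _ Y _ _ _
  simpa [pairDensity_bot] using hε

/-- The density of a uniform pair is close to the density of large subsets. -/
lemma SimpleGraph.IsUniform.abs_pairDensity_sub_lt {V : Type*} {G : SimpleGraph V} {ε δ : ℝ}
    {U W A B : Finset V} (h : G.IsUniform δ U W) (hε : 2 * δ ≤ ε) (hA : A ⊆ U) (hB : B ⊆ W)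
    (hUA : ε * #U ≤ 2 * #A) (hWB : ε * #W ≤ 2 * #B) :
    |pairDensity G A B - G.edgeDensity U W| < δ := by
  rw [pairDensity_eq_edgeDensity]
  apply h hA hB <;> nlinarith [(#U).cast_nonneg (α := ℝ), (#W).cast_nonneg (α := ℝ)]

/-- Large subsets of a uniform pair form a regular pair. -/
lemma SimpleGraph.IsUniform.isRegularPair {V : Type*} {G : SimpleGraph V} {ε δ : ℝ}
    {U W A B : Finset V} (h : G.IsUniform δ U W) (hε : 2 * δ ≤ ε) (hε₁ : ε ≤ 1)
    (hA : A ⊆ U) (hB : B ⊆ W) (hUA : (#U : ℝ) ≤ 2 * #A) (hWB : (#W : ℝ) ≤ 2 * #B) :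
    IsRegularPair G ε A B := by
  have hδ := h.pos
  intro X hX Y hY hXc hYc
  have h₁ := h.abs_pairDensity_sub_lt hε hA hB
    (by nlinarith [(#U).cast_nonneg (α := ℝ)]) (by nlinarith [(#W).cast_nonneg (α := ℝ)])
  have h₂ := h.abs_pairDensity_sub_lt hε (hX.trans hA) (hY.trans hB)
    (by nlinarith) (by nlinarith)
  rw [abs_lt] at *
  constructor <;> linarith

/-- In a uniform pair, few vertices have a degree much above the average. -/
lemma SimpleGraph.IsUniform.card_filter_degree_le {V : Type*} {G : SimpleGraph V} {δ : ℝ}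
    {U W : Finset V} (h : G.IsUniform δ U W) (hδ : δ ≤ 1) :
    (#{x ∈ U | (G.edgeDensity U W + δ) * #W < (#{y ∈ W | G.Adj x y} : ℝ)} : ℝ) ≤ δ * #U := by
  set X := {x ∈ U | (G.edgeDensity U W + δ) * #W < (#{y ∈ W | G.Adj x y} : ℝ)} with hX
  by_contra! hlt
  have hpos := h.pos
  have hXpos : (0 : ℝ) < #X := lt_of_le_of_lt (by positivity) hlt
  have hcnt : edgeCnt G X W = ∑ x ∈ X, #{y ∈ W | G.Adj x y} := by
    rw [edgeCnt, card_filter, sum_product]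
    simp only [card_filter]
  have hle : (#X : ℝ) * ((G.edgeDensity U W + δ) * #W) ≤ edgeCnt G X W := by
    rw [hcnt, ← nsmul_eq_mul]
    push_cast
    exact card_nsmul_le_sum _ _ _ fun x hx ↦ (mem_filter.1 hx).2.le
  have hWpos : (0 : ℝ) < #W := by
    obtain ⟨x, hx⟩ := card_pos.1 (Nat.cast_pos.1 hXpos)
    rcases W.eq_empty_or_nonempty with rfl | hW
    · simp [hX] at hx
    · exact_mod_cast hW.card_pos
  have hd := h (filter_subset _ _ : X ⊆ U) subset_rfl (by linarith) (by nlinarith)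
  rw [← pairDensity_eq_edgeDensity, pairDensity, abs_lt] at hd
  have : (G.edgeDensity U W + δ : ℝ) ≤ edgeCnt G X W / (#X * #W) := by
    rw [le_div_iff₀ (by positivity)]
    linarith
  linarith [hd.2]

/-- In a uniform equipartition, outside of a small exceptional set, a vertex sends few edges to
the parts which form a non-uniform or sparse pair with its own part. -/
lemma Finpartition.IsEquipartition.exists_exceptional_set {V : Type*} [Fintype V] [Nonempty V]
    {G : SimpleGraph V} {P : Finpartition (univ : Finset V)} {δ γ : ℝ} (hP : P.IsEquipartition)
    (hG : P.IsUniform G δ) (hδ : 0 < δ) (hδ₁ : δ ≤ 1) :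
    ∃ B : Finset V, γ * #B ≤ 5 * δ * Fintype.card V ∧
      ∀ x ∉ B, ∀ U ∈ P.parts, x ∈ U → ∀ S : Finset V, (∀ y ∈ S, G.Adj x y) → ∀ ρ : ℝ, 0 ≤ ρ →
        (∀ y ∈ S, ∀ W ∈ P.parts, y ∈ W →
          W = U ∨ ¬ G.IsUniform δ U W ∨ (G.edgeDensity U W : ℝ) ≤ ρ) →
        (#S : ℝ) ≤ #U + (γ + ρ + δ) * Fintype.card V := by
  set n : ℝ := (Fintype.card V : ℝ)
  have hnpos : 0 < n := Nat.cast_pos.2 Fintype.card_pos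
  have hsum : ∑ W ∈ P.parts, (#W : ℝ) = n := by
    rw [← Nat.cast_sum, P.sum_card_parts, card_univ]
  let high (U W : Finset V) : Finset V :=
    {x ∈ U | (G.edgeDensity U W + δ) * #W < (#{y ∈ W | G.Adj x y} : ℝ)}
  let unif := P.parts.offDiag.filter fun p ↦ G.IsUniform δ p.1 p.2
  let E₁ := (P.nonUniforms G δ).biUnion fun p ↦ p.1 ×ˢ p.2
  let E₂ := unif.biUnion fun p ↦ high p.1 p.2 ×ˢ p.2
  have hE₁ : (#E₁ : ℝ) ≤ 4 * δ * n ^ 2 :=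
    (Finpartition.IsEquipartition.sum_nonUniforms_lt univ_nonempty hδ hP hG).le
  have hE₂ : (#E₂ : ℝ) ≤ δ * n ^ 2 := by
    calc (#E₂ : ℝ) ≤ ∑ p ∈ unif, (#(high p.1 p.2 ×ˢ p.2) : ℝ) := mod_cast card_biUnion_le
      _ ≤ ∑ p ∈ unif, δ * (#p.1 * #p.2 : ℝ) := by
        refine sum_le_sum fun p hp ↦ ?_
        rw [card_product, Nat.cast_mul, ← mul_assoc]
        gcongr
        exact (mem_filter.1 hp).2.card_filter_degree_le hδ₁
      _ ≤ ∑ p ∈ P.parts ×ˢ P.parts, δ * (#p.1 * #p.2 : ℝ) := by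
        refine sum_le_sum_of_subset_of_nonneg ?_ fun _ _ _ ↦ by positivity
        intro p hp
        have hp' := mem_offDiag.1 (mem_filter.1 hp).1
        exact mem_product.2 ⟨hp'.1, hp'.2.1⟩
      _ = δ * n ^ 2 := by rw [← mul_sum, sum_product, ← hsum, sq, sum_mul_sum]
  let E := E₁ ∪ E₂
  have hE : (#E : ℝ) ≤ 5 * δ * n ^ 2 := by
    have : (#E : ℝ) ≤ #E₁ + #E₂ := mod_cast card_union_le _ _
    linarith
  let F (x : V) : Finset V := {y | (x, y) ∈ E}
  refine ⟨univ.filter fun x ↦ γ * n < #(F x), ?_, ?_⟩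
  · have hcard : ∑ x, #(F x) = #E := by
      simp only [F, card_filter]
      rw [← sum_product', univ_product_univ, ← card_filter]
      simp
    have : (#(univ.filter fun x ↦ γ * n < #(F x)) : ℝ) * (γ * n) ≤ #E := by
      rw [← hcard, ← nsmul_eq_mul]
      push_cast
      refine (card_nsmul_le_sum _ _ _ fun x hx ↦ (mem_filter.1 hx).2.le).trans ?_
      exact sum_le_sum_of_subset_of_nonneg (filter_subset _ _) fun _ _ _ ↦ by positivity
    refine le_of_mul_le_mul_right ?_ hnpos
    nlinarith
  · intro x hx U hU hxU S hS ρ hρ hS'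
    have hFx : (#(F x) : ℝ) ≤ γ * n := by simpa using hx
    let L := P.parts.filter fun W ↦ (#{y ∈ W | G.Adj x y} : ℝ) ≤ (ρ + δ) * #W
    have hsub : S ⊆ U ∪ F x ∪ L.biUnion fun W ↦ {y ∈ W | G.Adj x y} := by
      intro y hy
      obtain ⟨W, hW, hyW⟩ := P.exists_mem (mem_univ y)
      simp only [mem_union, mem_biUnion]
      by_cases hWU : W = U
      · exact .inl (.inl (hWU ▸ hyW))
      by_cases hu : G.IsUniform δ U W
      · have hd := ((hS' y hy W hW hyW).resolve_left hWU).resolve_left (not_not.2 hu)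
        by_cases hxh : x ∈ high U W
        · refine .inl (.inr (mem_filter.2 ⟨mem_univ _, mem_union_right _ ?_⟩))
          exact mem_biUnion.2 ⟨(U, W), mem_filter.2 ⟨mem_offDiag.2 ⟨hU, hW, Ne.symm hWU⟩, hu⟩,
            mem_product.2 ⟨hxh, hyW⟩⟩
        · refine .inr ⟨W, mem_filter.2 ⟨hW, ?_⟩, mem_filter.2 ⟨hyW, hS y hy⟩⟩
          have : (#{y ∈ W | G.Adj x y} : ℝ) ≤ (G.edgeDensity U W + δ) * #W :=
            not_lt.1 fun h ↦ hxh (mem_filter.2 ⟨hxU, h⟩)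
          exact this.trans (by gcongr)
      · refine .inl (.inr (mem_filter.2 ⟨mem_univ _, mem_union_left _ ?_⟩))
        exact mem_biUnion.2 ⟨(U, W), (P.mk_mem_nonUniforms G).2 ⟨hU, hW, Ne.symm hWU, hu⟩,
          mem_product.2 ⟨hxU, hyW⟩⟩
    have hL : (#(L.biUnion fun W ↦ {y ∈ W | G.Adj x y}) : ℝ) ≤ (ρ + δ) * n := by
      calc _ ≤ ∑ W ∈ L, (#{y ∈ W | G.Adj x y} : ℝ) := mod_cast card_biUnion_le
        _ ≤ ∑ W ∈ L, (ρ + δ) * (#W : ℝ) := sum_le_sum fun W hW ↦ (mem_filter.1 hW).2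
        _ ≤ ∑ W ∈ P.parts, (ρ + δ) * (#W : ℝ) :=
          sum_le_sum_of_subset_of_nonneg (filter_subset _ _) fun _ _ _ ↦ by positivity
        _ = (ρ + δ) * n := by rw [← mul_sum, hsum]
    have hcard : (#S : ℝ) ≤ #U + #(F x) + #(L.biUnion fun W ↦ {y ∈ W | G.Adj x y}) := by
      exact_mod_cast (card_le_card hsub).trans <|
        (card_union_le _ _).trans (Nat.add_le_add_right (card_union_le _ _) _)
    linarith

/-- Removing a small set from an equipartition, most parts still contain large disjoint subsets
of a common size. -/
lemma Finpartition.IsEquipartition.exists_equal_subparts {V : Type*} [Fintype V]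
    {P : Finpartition (univ : Finset V)} {η : ℝ} (hP : P.IsEquipartition) (B : Finset V)
    (hη : 0 < η) (hη₁ : 8 * η ≤ 1) (hq : 1 ≤ η * (Fintype.card V / #P.parts : ℕ))
    (hB : 4 * (#B : ℝ) ≤ η ^ 2 * Fintype.card V) :
    ∃ (k m : ℕ) (U Q : Fin k → Finset V), Function.Injective U ∧
      (∀ i, U i ∈ P.parts ∧ Q i ⊆ U i ∧ Disjoint (Q i) B ∧ #(Q i) = m ∧ #(U i) ≤ 2 * m) ∧
      #P.parts ≤ 2 * k ∧ k ≤ #P.parts ∧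
      (Fintype.card V : ℝ) ≤ k * m + 4 * η * Fintype.card V := by
  set n : ℝ := (Fintype.card V : ℝ)
  set t := #P.parts
  set q := Fintype.card V / t
  set m := ⌊(1 - η) * q⌋₊
  have hq₈ : (8 : ℝ) ≤ q := by nlinarith [(q.cast_nonneg : (0 : ℝ) ≤ q)]
  have hm₁ : (m : ℝ) ≤ (1 - η) * q := Nat.floor_le (by nlinarith)
  have hm₂ : (1 - η) * q < m + 1 := Nat.lt_floor_add_one _
  have hlow : ∀ W ∈ P.parts, (q : ℝ) ≤ #W := fun W hW ↦ by
    exact_mod_cast hP.average_le_card_part hW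
  have hupp : ∀ W ∈ P.parts, (#W : ℝ) ≤ q + 1 := fun W hW ↦ by
    exact_mod_cast hP.card_part_le_average_add_one hW
  have htq : (t : ℝ) * q ≤ n := by
    rw [← Nat.cast_mul]
    exact Nat.cast_le.2 (Nat.mul_div_le _ _)
  have hntq : n ≤ t * (q + 1) := by
    have h := sum_le_card_nsmul P.parts (fun W ↦ (#W : ℝ)) _ hupp
    rw [← Nat.cast_sum, P.sum_card_parts, nsmul_eq_mul] at h
    exact h
  let good := P.parts.filter fun W ↦ m ≤ #(W \ B)
  let bad := P.parts.filter fun W ↦ ¬ m ≤ #(W \ B)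
  have hgb : (#good : ℝ) + #bad = t := by
    exact_mod_cast card_filter_add_card_filter_not (s := P.parts) fun W ↦ m ≤ #(W \ B)
  have hbad : (#bad : ℝ) * (η * q) ≤ #B := by
    calc (#bad : ℝ) * (η * q) ≤ ∑ W ∈ bad, (#(W ∩ B) : ℝ) := by
          rw [← nsmul_eq_mul]
          refine card_nsmul_le_sum _ _ _ fun W hW ↦ ?_
          obtain ⟨hW, hWm⟩ := mem_filter.1 hW
          have h₁ : (#(W \ B) : ℝ) + #(W ∩ B) = #W := by
            exact_mod_cast card_sdiff_add_card_inter W B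
          have h₂ : (#(W \ B) : ℝ) ≤ m := by exact_mod_cast (not_le.1 hWm).le
          linarith [hlow W hW]
      _ = #(bad.biUnion fun W ↦ W ∩ B) := by
          rw [card_biUnion, Nat.cast_sum]
          intro W hW W' hW' hne
          exact (P.disjoint (mem_filter.1 hW).1 (mem_filter.1 hW').1 hne).mono
            inter_subset_left inter_subset_left
      _ ≤ #B := by
          gcongr
          exact biUnion_subset.2 fun W _ ↦ inter_subset_right
  have hbt : 4 * (#bad : ℝ) ≤ η * (2 * t) := by
    have h₁ : 4 * (#bad : ℝ) * (η * q) ≤ η * (2 * t) * (η * q) := by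
      calc 4 * (#bad : ℝ) * (η * q) ≤ η ^ 2 * n := by linarith
        _ ≤ η ^ 2 * (t * (2 * q)) := by
          gcongr
          exact hntq.trans (by gcongr; linarith)
        _ = _ := by ring
    exact le_of_mul_le_mul_right h₁ (by linarith)
  have hQ : ∀ W : good, ∃ Q ⊆ W.1 \ B, #Q = m := fun W ↦
    exists_subset_card_eq (mem_filter.1 W.2).2
  choose Q hQ hQm using hQ
  have hU : ∀ i, (good.equivFin.symm i).1 ∈ P.parts := fun i ↦
    (mem_filter.1 (good.equivFin.symm i).2).1
  have ht₀ : (0 : ℝ) ≤ t := t.cast_nonneg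
  refine ⟨#good, m, fun i ↦ (good.equivFin.symm i).1, fun i ↦ Q (good.equivFin.symm i),
    Subtype.val_injective.comp (Equiv.injective _), fun i ↦ ⟨hU i, (hQ _).trans sdiff_subset,
      disjoint_of_subset_left (hQ _) sdiff_disjoint, hQm _, ?_⟩, ?_, ?_, ?_⟩
  · have := hupp _ (hU i)
    have h : (#(good.equivFin.symm i).1 : ℝ) ≤ 2 * m := by nlinarith
    exact_mod_cast h
  · have : (t : ℝ) ≤ 2 * #good := by nlinarith
    exact_mod_cast this
  · exact card_filter_le _ _
  · have hgt : (#good : ℝ) ≤ t := by linarith [(#bad).cast_nonneg (α := ℝ)]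
    have h₁ : (#good : ℝ) * (q + 1 - m) ≤ t * (3 * (η * q)) :=
      (mul_le_mul_of_nonneg_left (by linarith) (Nat.cast_nonneg _)).trans
        (mul_le_mul_of_nonneg_right hgt (by linarith))
    have h₂ : (#bad : ℝ) * (q + 1) ≤ η * t / 2 * (2 * q) := by
      gcongr <;> linarith
    have h₃ : η * (t * q) ≤ η * n := by gcongr
    calc n ≤ (#good + #bad) * (q + 1) := by rwa [hgb]
      _ = #good * m + (#good * (q + 1 - m) + #bad * (q + 1)) := by ring
      _ ≤ #good * m + 4 * η * n := by linarith

/-- The subgraph of `G` obtained by deleting the edges inside each `Q i`, and those between `Q i`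
and `Q j` unless this pair is `ε`-regular of density greater than `d`. -/
def prunedGraph {V ι : Type*} (G : SimpleGraph V) (ε d : ℝ) (Q : ι → Finset V) :
    SimpleGraph V where
  Adj x y := G.Adj x y ∧ ∀ i j, x ∈ Q i → y ∈ Q j →
    i ≠ j ∧ IsRegularPair G ε (Q i) (Q j) ∧ d < pairDensity G (Q i) (Q j)
  symm := ⟨fun x y h ↦ ⟨h.1.symm, fun i j hi hj ↦ by
    obtain ⟨hne, hreg, hd⟩ := h.2 j i hj hi
    exact ⟨hne.symm, hreg.symm, by rwa [pairDensity_comm]⟩⟩⟩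

lemma prunedGraph_pair {V ι : Type*} {G : SimpleGraph V} {ε d : ℝ} {Q : ι → Finset V}
    (hε : 0 < ε) (hQ : ∀ i j, i ≠ j → Disjoint (Q i) (Q j)) {i j : ι} (hij : i ≠ j) :
    IsRegularPair (prunedGraph G ε d Q) ε (Q i) (Q j) ∧
      (pairDensity (prunedGraph G ε d Q) (Q i) (Q j) = 0 ∨
        d < pairDensity (prunedGraph G ε d Q) (Q i) (Q j)) := by
  have huniq : ∀ {x i j}, x ∈ Q i → x ∈ Q j → i = j := fun {x i j} hi hj ↦ by
    by_contra h
    exact disjoint_left.1 (hQ i j h) hi hj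
  by_cases h : IsRegularPair G ε (Q i) (Q j) ∧ d < pairDensity G (Q i) (Q j)
  · have hadj : ∀ x ∈ Q i, ∀ y ∈ Q j, (G.Adj x y ↔ (prunedGraph G ε d Q).Adj x y) := by
      refine fun x hx y hy ↦ ⟨fun hG ↦ ⟨hG, fun i' j' hi' hj' ↦ ?_⟩, fun hG ↦ hG.1⟩
      obtain rfl := huniq hx hi'
      obtain rfl := huniq hy hj'
      exact ⟨hij, h⟩
    exact ⟨h.1.congr hadj, .inr (pairDensity_congr hadj ▸ h.2)⟩
  · have hadj : ∀ x ∈ Q i, ∀ y ∈ Q j,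
        ((⊥ : SimpleGraph V).Adj x y ↔ (prunedGraph G ε d Q).Adj x y) :=
      fun x hx y hy ↦ ⟨False.elim, fun hG ↦ h (hG.2 i j hx hy).2⟩
    exact ⟨(isRegularPair_bot hε _ _).congr hadj,
      .inl (pairDensity_congr hadj ▸ pairDensity_bot _ _)⟩

/-- **Degree form of the Regularity Lemma.** -/
theorem degree_form_regularity (ε : ℝ) (hε : 0 < ε) (k₀ : ℕ) (hk₀ : 0 < k₀) :
    ∃ N : ℕ, ∀ (d : ℝ), 0 ≤ d → d < 1 →
      ∀ (V : Type) [Fintype V] (G : SimpleGraph V),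
      N ≤ Fintype.card V →
      ∃ (k : ℕ) (V₀ : Finset V) (P : Fin k → Finset V) (G' : SimpleGraph V),
        -- G' is a spanning subgraph of G
        G' ≤ G ∧
        -- the sets form a partition of the vertex set
        (∀ i, Disjoint V₀ (P i)) ∧
        (∀ i j, i ≠ j → Disjoint (P i) (P j)) ∧
        (∀ v : V, v ∈ V₀ ∨ ∃ i, v ∈ P i) ∧
        -- (i)
        k₀ ≤ k ∧ k ≤ N ∧ (V₀.card : ℝ) ≤ ε * (Fintype.card V : ℝ) ∧
        -- (ii)
        (∃ m : ℕ, ∀ i, (P i).card = m) ∧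
        -- (iii)
        (∀ x : V, (G.degree x : ℝ) - (d + ε) * (Fintype.card V : ℝ) < (G'.degree x : ℝ)) ∧
        -- (iv)
        (∀ i, ∀ x ∈ P i, ∀ y ∈ P i, ¬ G'.Adj x y) ∧
        -- (v)
        (∀ i j : Fin k, i < j →
          IsRegularPair G' ε (P i) (P j) ∧
          (pairDensity G' (P i) (P j) = 0 ∨ d < pairDensity G' (P i) (P j))) := by
  obtain hε₁ | hε₁ := le_or_gt 1 ε
  · refine ⟨k₀, fun d hd _ V _ G hN ↦ ⟨k₀, univ, fun _ ↦ ∅, G, le_rfl, by simp, by simp, by simp,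
      le_rfl, le_rfl, ?_, ⟨0, by simp⟩, fun x ↦ ?_, by simp, fun i j _ ↦ ⟨?_, .inl ?_⟩⟩⟩
    · rw [card_univ]
      exact le_mul_of_one_le_left (Nat.cast_nonneg _) hε₁
    · have : (0 : ℝ) < Fintype.card V := by exact_mod_cast hk₀.trans_le hN
      linarith [mul_pos (add_pos_of_nonneg_of_pos hd hε) this]
    · intro X hX Y hY _ _
      rw [subset_empty.1 hX, subset_empty.1 hY]
      simpa using hε
    · simp [pairDensity]
  set δ := ε ^ 3 / 12000 with hδdef
  have hδ : 0 < δ := by positivity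
  have hε₂ : ε ^ 2 < 1 := by nlinarith
  have hδε : 12000 * δ < ε := by
    have : 12000 * δ = ε ^ 2 * ε := by rw [hδdef]; ring
    nlinarith
  set l := max (2 * k₀) ⌈8 / ε⌉₊
  set c := ⌈12 / ε⌉₊
  have hc : 0 < c := Nat.ceil_pos.2 (by positivity)
  refine ⟨SzemerediRegularity.bound δ l * c, fun d hd _ V _ G hN ↦ ?_⟩
  have hbN : SzemerediRegularity.bound δ l ≤ SzemerediRegularity.bound δ l * c :=
    Nat.le_mul_of_pos_right _ hc
  have hnpos : 0 < Fintype.card V :=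
    (SzemerediRegularity.bound_pos δ l).trans_le (hbN.trans hN)
  have hV : Nonempty V := Fintype.card_pos_iff.1 hnpos
  obtain ⟨P, hP, hlP, hPb, hPG⟩ := szemeredi_regularity G hδ
    (((SzemerediRegularity.le_bound δ l).trans hbN).trans hN)
  have hq : c ≤ Fintype.card V / #P.parts := by
    rw [Nat.le_div_iff_mul_le ((P.parts_nonempty univ_nonempty.ne_empty).card_pos), mul_comm]
    exact (Nat.mul_le_mul_right _ hPb).trans hN
  obtain ⟨B, hB, hBS⟩ := hP.exists_exceptional_set (γ := ε / 4) hPG hδ (by linarith)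
  set n : ℝ := (Fintype.card V : ℝ)
  have hn : 0 < n := Nat.cast_pos.2 hnpos
  have hcq : 12 / ε ≤ (Fintype.card V / #P.parts : ℕ) :=
    (Nat.le_ceil _).trans (Nat.cast_le.2 hq)
  have hηq : 1 ≤ ε / 12 * (Fintype.card V / #P.parts : ℕ) := by
    rw [div_le_iff₀ hε] at hcq
    linarith
  have hBη : 4 * (#B : ℝ) ≤ (ε / 12) ^ 2 * n := by
    refine le_of_mul_le_mul_left ?_ hε
    calc ε * (4 * (#B : ℝ)) = 16 * (ε / 4 * #B) := by ring
      _ ≤ 16 * (5 * δ * n) := by gcongr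
      _ = ε ^ 3 / 150 * n := by rw [hδdef]; ring
      _ ≤ ε ^ 3 / 144 * n := by gcongr; norm_num
      _ = _ := by ring
  obtain ⟨k, m, U, Q, hU, hUQ, hPk, hkP, hkm⟩ :=
    hP.exists_equal_subparts B (by positivity) (by linarith) hηq hBη
  choose hUP hQU hQB hQm hUm using hUQ
  have hdisj : ∀ i j, i ≠ j → Disjoint (Q i) (Q j) := fun i j hij ↦
    (P.disjoint (hUP i) (hUP j) (hU.ne hij)).mono (hQU i) (hQU j)
  have hUcard : ∀ i, (#(U i) : ℝ) ≤ ε / 4 * n := fun i ↦ by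
    have h₁ : (#(U i) : ℝ) ≤ (Fintype.card V / #P.parts : ℕ) + 1 := by
      exact_mod_cast hP.card_part_le_average_add_one (hUP i)
    have h₂ : (#P.parts : ℝ) * (Fintype.card V / #P.parts : ℕ) ≤ n := by
      rw [← Nat.cast_mul]
      exact Nat.cast_le.2 (Nat.mul_div_le _ _)
    have h₃ : 8 / ε ≤ #P.parts :=
      (Nat.le_ceil _).trans (Nat.cast_le.2 ((le_max_right _ _).trans hlP))
    have h₄ : 8 / ε * (Fintype.card V / #P.parts : ℕ) ≤ n :=
      (mul_le_mul_of_nonneg_right h₃ (Nat.cast_nonneg _)).trans h₂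
    rw [div_mul_eq_mul_div, div_le_iff₀ hε] at h₄
    have h₅ : (1 : ℝ) ≤ (Fintype.card V / #P.parts : ℕ) := by exact_mod_cast hc.trans_le hq
    linarith
  refine ⟨k, univ \ univ.biUnion Q, Q, prunedGraph G ε d Q, fun _ _ h ↦ h.1, fun i ↦ ?_, hdisj,
    fun v ↦ ?_, ?_, (hkP.trans hPb).trans hbN, ?_, ⟨m, hQm⟩, fun x ↦ ?_,
    fun i x hx y hy h ↦ (h.2 i i hx hy).1 rfl, fun i j hij ↦ prunedGraph_pair hε hdisj hij.ne⟩
  · exact disjoint_of_subset_right (subset_biUnion_of_mem Q (mem_univ i)) sdiff_disjoint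
  · by_cases h : ∃ i, v ∈ Q i
    · exact .inr h
    · exact .inl (by simpa using h)
  · have := (le_max_left _ _).trans hlP
    omega
  · have h₁ : #(univ.biUnion Q) = k * m := by
      rw [card_biUnion fun i _ j _ ↦ hdisj i j]
      simp [hQm]
    have h₂ : (#(univ \ univ.biUnion Q) : ℝ) + k * m = n := by
      rw [← Nat.cast_mul, ← h₁, ← Nat.cast_add, card_sdiff_add_card_eq_card (subset_univ _),
        card_univ]
    nlinarith
  · set S : Finset V := {y | G.Adj x y ∧ ¬ (prunedGraph G ε d Q).Adj x y}
    have hdeg : (G.degree x : ℝ) ≤ (prunedGraph G ε d Q).degree x + #S := by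
      rw [← Nat.cast_add, Nat.cast_le, ← SimpleGraph.card_neighborFinset_eq_degree,
        ← SimpleGraph.card_neighborFinset_eq_degree]
      refine (card_le_card fun y hy ↦ ?_).trans (card_union_le _ _)
      rw [SimpleGraph.mem_neighborFinset] at hy
      rw [mem_union, SimpleGraph.mem_neighborFinset, mem_filter]
      by_cases h : (prunedGraph G ε d Q).Adj x y
      · exact .inl h
      · exact .inr ⟨mem_univ _, hy, h⟩
    have hSlt : (#S : ℝ) < (d + ε) * n := by
      by_cases hx : ∃ i, x ∈ Q i
      · obtain ⟨i, hx⟩ := hx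
        have := hBS x (disjoint_left.1 (hQB i) hx) (U i) (hUP i) (hQU i hx) S
          (fun y hy ↦ (mem_filter.1 hy).2.1) (d + δ) (by positivity) fun y hy W hW hyW ↦ by
            obtain ⟨-, hG, hG'⟩ := mem_filter.1 hy
            by_contra! h
            refine hG' ⟨hG, fun i' j hi' hj ↦ ?_⟩
            obtain rfl : i = i' := by
              by_contra hne
              exact disjoint_left.1 (hdisj _ _ hne) hx hi'
            obtain rfl := P.eq_of_mem_parts hW (hUP j) hyW (hQU j hj)
            have hcard : ∀ j, (#(U j) : ℝ) ≤ 2 * #(Q j) := fun j ↦ by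
              rw [hQm]
              exact_mod_cast hUm j
            have hclose := h.2.1.abs_pairDensity_sub_lt (ε := 1) (by linarith) (hQU i) (hQU j)
              (by linarith [hcard i]) (by linarith [hcard j])
            refine ⟨fun hij ↦ h.1 (hij ▸ rfl), h.2.1.isRegularPair (by linarith) hε₁.le (hQU i)
              (hQU j) (hcard i) (hcard j), ?_⟩
            linarith [(abs_lt.1 hclose).1, h.2.2]
        have h₁ := hUcard i
        have h₂ : (ε / 4 + ε / 4 + 2 * δ) * n < ε * n := by gcongr; linarith
        linarith
      · have : S = ∅ := filter_eq_empty_iff.2 fun y _ h ↦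
          h.2 ⟨h.1, fun i _ hi ↦ (hx ⟨i, hi⟩).elim⟩
        rw [this, card_empty, Nat.cast_zero]
        positivity
    linarith
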